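/- The composition ω ∘ φ : G_{n,p}^2 → G_{n+1}^2 / ⟨⟨[a_{i(n+1)}, a_{j(n+1)}]⟩⟩, sending a_{ij}^0 ↦ a_{ij} and a_{ij}^1 ↦ a_{i(n+1)} a_{ij} a_{i(n+1)}, is an injective group homomorphism. -/

import Mathlib

abbrev GenG (n : ℕ) := {p : Fin n × Fin n // p.1 < p.2}

def relsG (n : ℕ) : Set (FreeGroup (GenG n)) :=
  {r | (∃ a : GenG n, r = .of a * .of a) ∨
    (∃ a b : GenG n, ({a.1.1, a.1.2, b.1.1, b.1.2} : Finset (Fin n)).card = 4 ∧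
      r = .of a * .of b * (.of b * .of a)⁻¹) ∨
    (∃ i j k : Fin n, ∃ hij : i < j, ∃ hik : i < k, ∃ hjk : j < k,
      r = .of ⟨(i,j),hij⟩ * .of ⟨(i,k),hik⟩ * .of ⟨(j,k),hjk⟩ *
          (.of ⟨(j,k),hjk⟩ * .of ⟨(i,k),hik⟩ * .of ⟨(i,j),hij⟩)⁻¹)}

abbrev G2 (n : ℕ) := PresentedGroup (relsG n)

abbrev GenP (n : ℕ) := GenG n × Bool

def relsP (n : ℕ) : Set (FreeGroup (GenP n)) :=
  {r | (∃ a : GenP n, r = .of a * .of a) ∨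
    (∃ a b : GenG n, ∃ e₁ e₂ : Bool, ({a.1.1, a.1.2, b.1.1, b.1.2} : Finset (Fin n)).card = 4 ∧
      r = .of (a,e₁) * .of (b,e₂) * (.of (b,e₂) * .of (a,e₁))⁻¹) ∨
    (∃ i j k : Fin n, ∃ hij : i < j, ∃ hik : i < k, ∃ hjk : j < k, ∃ e₁ e₂ e₃ : Bool,
      Bool.xor e₁ (Bool.xor e₂ e₃) = false ∧
      r = .of (⟨(i,j),hij⟩,e₁) * .of (⟨(i,k),hik⟩,e₂) * .of (⟨(j,k),hjk⟩,e₃) *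
          (.of (⟨(j,k),hjk⟩,e₃) * .of (⟨(i,k),hik⟩,e₂) * .of (⟨(i,j),hij⟩,e₁))⁻¹)}

abbrev G2p (n : ℕ) := PresentedGroup (relsP n)

def embedGen (n : ℕ) (a : GenG n) : GenG (n+1) :=
  ⟨(a.1.1.castSucc, a.1.2.castSucc), Fin.castSucc_lt_castSucc_iff.mpr a.2⟩

def tauGen (n : ℕ) (i : Fin n) : GenG (n+1) := ⟨(i.castSucc, Fin.last n), Fin.castSucc_lt_last i⟩

def QRels (n : ℕ) : Set (G2 (n+1)) :=
  {x | ∃ i j : Fin n, i ≠ j ∧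
    x = PresentedGroup.of (tauGen n i) * PresentedGroup.of (tauGen n j) *
        (PresentedGroup.of (tauGen n j) * PresentedGroup.of (tauGen n i))⁻¹}

abbrev Qgrp (n : ℕ) := G2 (n+1) ⧸ Subgroup.normalClosure (QRels n)

theorem ne_of_card_insert_eq_four {α : Type*} [DecidableEq α] {a b c d : α}
    (h : ({a, b, c, d} : Finset α).card = 4) :
    a ≠ c ∧ a ≠ d ∧ b ≠ c ∧ b ≠ d := by
  refine ⟨?_, ?_, ?_, ?_⟩ <;> rintro rfl
  · have := Finset.card_le_three (a := a) (b := b) (c := d)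
    simp_all [Finset.insert_comm b a]
  · have := Finset.card_le_three (a := a) (b := b) (c := c)
    have e : ({a, b, c, a} : Finset α) = {a, b, c} := by ext; simp; tauto
    rw [e] at h; omega
  · have := Finset.card_le_three (a := a) (b := b) (c := d)
    have e : ({a, b, b, d} : Finset α) = {a, b, d} := by ext; simp
    rw [e] at h; omega
  · have := Finset.card_le_three (a := a) (b := b) (c := c)
    have e : ({a, b, c, b} : Finset α) = {a, b, c} := by ext; simp; tauto
    rw [e] at h; omega

theorem card_insert_eq_four {α : Type*} [DecidableEq α] {a b c d : α}
    (hab : a ≠ b) (hcd : c ≠ d) (hac : a ≠ c) (had : a ≠ d) (hbc : b ≠ c) (hbd : b ≠ d) :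
    ({a, b, c, d} : Finset α).card = 4 := by
  simp [*]

section Presentations

variable {n : ℕ}

theorem G2.of_mul_self (a : GenG n) :
    (PresentedGroup.of a : G2 n) * PresentedGroup.of a = 1 :=
  PresentedGroup.one_of_mem (rels := relsG n) (Or.inl ⟨a, rfl⟩)

theorem G2.of_comm {a b : GenG n}
    (h : ({a.1.1, a.1.2, b.1.1, b.1.2} : Finset (Fin n)).card = 4) :
    (PresentedGroup.of a : G2 n) * PresentedGroup.of b =
      PresentedGroup.of b * PresentedGroup.of a :=
  mul_inv_eq_one.mp <|
    PresentedGroup.one_of_mem (rels := relsG n) (Or.inr (Or.inl ⟨a, b, h, rfl⟩))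

theorem G2.of_triple {i j k : Fin n} (hij : i < j) (hik : i < k) (hjk : j < k) :
    (PresentedGroup.of ⟨(i, j), hij⟩ : G2 n) * PresentedGroup.of ⟨(i, k), hik⟩ *
        PresentedGroup.of ⟨(j, k), hjk⟩ =
      PresentedGroup.of ⟨(j, k), hjk⟩ * PresentedGroup.of ⟨(i, k), hik⟩ *
        PresentedGroup.of ⟨(i, j), hij⟩ :=
  mul_inv_eq_one.mp <|
    PresentedGroup.one_of_mem (rels := relsG n) (Or.inr (Or.inr ⟨i, j, k, hij, hik, hjk, rfl⟩))

theorem G2p.of_mul_self (a : GenP n) :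
    (PresentedGroup.of a : G2p n) * PresentedGroup.of a = 1 :=
  PresentedGroup.one_of_mem (rels := relsP n) (Or.inl ⟨a, rfl⟩)

theorem G2p.of_comm {a b : GenG n} (e₁ e₂ : Bool)
    (h : ({a.1.1, a.1.2, b.1.1, b.1.2} : Finset (Fin n)).card = 4) :
    (PresentedGroup.of (a, e₁) : G2p n) * PresentedGroup.of (b, e₂) =
      PresentedGroup.of (b, e₂) * PresentedGroup.of (a, e₁) :=
  mul_inv_eq_one.mp <|
    PresentedGroup.one_of_mem (rels := relsP n) (Or.inr (Or.inl ⟨a, b, e₁, e₂, h, rfl⟩))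

theorem G2p.of_triple {i j k : Fin n} (hij : i < j) (hik : i < k) (hjk : j < k)
    {e₁ e₂ e₃ : Bool} (he : Bool.xor e₁ (Bool.xor e₂ e₃) = false) :
    (PresentedGroup.of (⟨(i, j), hij⟩, e₁) : G2p n) * PresentedGroup.of (⟨(i, k), hik⟩, e₂) *
        PresentedGroup.of (⟨(j, k), hjk⟩, e₃) =
      PresentedGroup.of (⟨(j, k), hjk⟩, e₃) * PresentedGroup.of (⟨(i, k), hik⟩, e₂) *
        PresentedGroup.of (⟨(i, j), hij⟩, e₁) :=
  mul_inv_eq_one.mp <| PresentedGroup.one_of_mem (rels := relsP n)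
    (Or.inr (Or.inr ⟨i, j, k, hij, hik, hjk, e₁, e₂, e₃, he, rfl⟩))

/-- A family satisfying the defining relations of `G2 n` kills every relator. -/
theorem G2.lift_eq_one {G : Type*} [Group G] {F : GenG n → G}
    (hsq : ∀ a, F a * F a = 1)
    (hcomm : ∀ a b : GenG n, ({a.1.1, a.1.2, b.1.1, b.1.2} : Finset (Fin n)).card = 4 →
      F a * F b = F b * F a)
    (htriple : ∀ (i j k : Fin n) (hij : i < j) (hik : i < k) (hjk : j < k),
      F ⟨(i, j), hij⟩ * F ⟨(i, k), hik⟩ * F ⟨(j, k), hjk⟩ =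
        F ⟨(j, k), hjk⟩ * F ⟨(i, k), hik⟩ * F ⟨(i, j), hij⟩) :
    ∀ r ∈ relsG n, FreeGroup.lift F r = 1 := by
  rintro r (⟨a, rfl⟩ | ⟨a, b, h, rfl⟩ | ⟨i, j, k, hij, hik, hjk, rfl⟩)
  · simpa using hsq a
  · simpa only [map_mul, map_inv, FreeGroup.lift_apply_of, mul_inv_eq_one] using hcomm a b h
  · simpa only [map_mul, map_inv, FreeGroup.lift_apply_of, mul_inv_eq_one] using
      htriple i j k hij hik hjk

/-- A family satisfying the defining relations of `G2p n` kills every relator. -/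
theorem G2p.lift_eq_one {G : Type*} [Group G] {F : GenP n → G}
    (hsq : ∀ a, F a * F a = 1)
    (hcomm : ∀ (a b : GenG n) (e₁ e₂ : Bool),
      ({a.1.1, a.1.2, b.1.1, b.1.2} : Finset (Fin n)).card = 4 →
      F (a, e₁) * F (b, e₂) = F (b, e₂) * F (a, e₁))
    (htriple : ∀ (i j k : Fin n) (hij : i < j) (hik : i < k) (hjk : j < k) (e₁ e₂ e₃ : Bool),
      Bool.xor e₁ (Bool.xor e₂ e₃) = false →
      F (⟨(i, j), hij⟩, e₁) * F (⟨(i, k), hik⟩, e₂) * F (⟨(j, k), hjk⟩, e₃) =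
        F (⟨(j, k), hjk⟩, e₃) * F (⟨(i, k), hik⟩, e₂) * F (⟨(i, j), hij⟩, e₁)) :
    ∀ r ∈ relsP n, FreeGroup.lift F r = 1 := by
  rintro r (⟨a, rfl⟩ | ⟨a, b, e₁, e₂, h, rfl⟩ | ⟨i, j, k, hij, hik, hjk, e₁, e₂, e₃, he, rfl⟩)
  · simpa using hsq a
  · simpa only [map_mul, map_inv, FreeGroup.lift_apply_of, mul_inv_eq_one] using
      hcomm a b e₁ e₂ h
  · simpa only [map_mul, map_inv, FreeGroup.lift_apply_of, mul_inv_eq_one] using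
      htriple i j k hij hik hjk e₁ e₂ e₃ he

end Presentations

section Flip

variable {n : ℕ}

/-- Change the parity of a generator once for each of its endpoints selected by `s`. -/
def flipGen (s : Fin n → Bool) (x : GenP n) : GenP n :=
  (x.1, Bool.xor x.2 (Bool.xor (s x.1.1.1) (s x.1.1.2)))

theorem flipGen_lift_eq_one (s : Fin n → Bool) :
    ∀ r ∈ relsP n,
      FreeGroup.lift (fun x => (PresentedGroup.of (flipGen s x) : G2p n)) r = 1 := by
  refine G2p.lift_eq_one (fun a => G2p.of_mul_self _) (fun a b _ _ h => G2p.of_comm _ _ h) ?_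
  intro i j k hij hik hjk e₁ e₂ e₃ he
  refine G2p.of_triple hij hik hjk ?_
  revert he
  cases e₁ <;> cases e₂ <;> cases e₃ <;> cases s i <;> cases s j <;> cases s k <;> simp

/-- The endomorphism of `G2p n` induced by `flipGen`. -/
def flipHom (s : Fin n → Bool) : G2p n →* G2p n :=
  PresentedGroup.toGroup (flipGen_lift_eq_one s)

theorem flipHom_of (s : Fin n → Bool) (x : GenP n) :
    flipHom s (PresentedGroup.of x) = PresentedGroup.of (flipGen s x) :=
  PresentedGroup.toGroup.of _

theorem flipHom_comp_self (s : Fin n → Bool) :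
    (flipHom s).comp (flipHom s) = MonoidHom.id (G2p n) := by
  ext x
  simp [flipHom_of, flipGen]

/-- The automorphism of `G2p n` induced by `flipGen`. -/
def flipAut (s : Fin n → Bool) : MulAut (G2p n) :=
  MonoidHom.toMulEquiv (flipHom s) (flipHom s) (flipHom_comp_self s) (flipHom_comp_self s)

theorem flipAut_of (s : Fin n → Bool) (x : GenP n) :
    flipAut s (PresentedGroup.of x) = PresentedGroup.of (flipGen s x) :=
  flipHom_of s x

theorem flipAut_mul_self (s : Fin n → Bool) : flipAut s * flipAut s = 1 :=
  MulEquiv.ext fun x => DFunLike.congr_fun (flipHom_comp_self s) x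

theorem flipAut_comm (s t : Fin n → Bool) : flipAut s * flipAut t = flipAut t * flipAut s := by
  have h : (flipHom s).comp (flipHom t) = (flipHom t).comp (flipHom s) := by
    ext x
    simp only [MonoidHom.comp_apply, flipHom_of, flipGen]
    congr 2
    cases x.2 <;> cases s x.1.1.1 <;> cases s x.1.1.2 <;> cases t x.1.1.1 <;>
      cases t x.1.1.2 <;> rfl
  exact MulEquiv.ext fun x => DFunLike.congr_fun h x

end Flip

section Forward

variable {n : ℕ}

/-- The image of `a_{ij}` in the quotient group. -/
def quotA (a : GenG n) : Qgrp n := QuotientGroup.mk (PresentedGroup.of (embedGen n a))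

/-- The image of `τ_i` in the quotient group. -/
def quotT (i : Fin n) : Qgrp n := QuotientGroup.mk (PresentedGroup.of (tauGen n i))

theorem quotA_mul_self (a : GenG n) : quotA a * quotA a = 1 :=
  congrArg (QuotientGroup.mk' _) (G2.of_mul_self (embedGen n a))

theorem quotT_mul_self (i : Fin n) : quotT i * quotT i = 1 :=
  congrArg (QuotientGroup.mk' _) (G2.of_mul_self (tauGen n i))

theorem quotT_inv (i : Fin n) : (quotT i)⁻¹ = quotT i :=
  inv_eq_of_mul_eq_one_left (quotT_mul_self i)

theorem quotT_commute (i j : Fin n) : Commute (quotT i) (quotT j) := by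
  by_cases h : i = j
  · rw [h]
  · have hmem := (QuotientGroup.eq_one_iff _).mpr
      (Subgroup.subset_normalClosure (s := QRels n) ⟨i, j, h, rfl⟩)
    exact mul_inv_eq_one.mp hmem

theorem quotA_commute {a b : GenG n}
    (h : ({a.1.1, a.1.2, b.1.1, b.1.2} : Finset (Fin n)).card = 4) :
    Commute (quotA a) (quotA b) := by
  refine congrArg (QuotientGroup.mk' _) (G2.of_comm ?_)
  obtain ⟨h₁, h₂, h₃, h₄⟩ := ne_of_card_insert_eq_four h
  have ha := a.2.ne
  have hb := b.2.ne
  apply card_insert_eq_four <;> simpa [embedGen]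

theorem quotT_commute_quotA {k : Fin n} {a : GenG n} (h₁ : k ≠ a.1.1) (h₂ : k ≠ a.1.2) :
    Commute (quotT k) (quotA a) := by
  refine congrArg (QuotientGroup.mk' _) (G2.of_comm ?_)
  have ha := a.2.ne
  apply card_insert_eq_four <;> simp [embedGen, tauGen, (Fin.castSucc_ne_last _).symm, *]

theorem quotA_triple {i j k : Fin n} (hij : i < j) (hik : i < k) (hjk : j < k) :
    quotA ⟨(i, j), hij⟩ * quotA ⟨(i, k), hik⟩ * quotA ⟨(j, k), hjk⟩ =
      quotA ⟨(j, k), hjk⟩ * quotA ⟨(i, k), hik⟩ * quotA ⟨(i, j), hij⟩ :=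
  congrArg (QuotientGroup.mk' _) (G2.of_triple (embedGen n ⟨(i, j), hij⟩).2
    (embedGen n ⟨(i, k), hik⟩).2 (embedGen n ⟨(j, k), hjk⟩).2)

theorem quotA_mul_quotT (a : GenG n) :
    quotA a * quotT a.1.1 * quotT a.1.2 = quotT a.1.2 * quotT a.1.1 * quotA a :=
  congrArg (QuotientGroup.mk' _) (G2.of_triple (embedGen n a).2
    (tauGen n a.1.1).2 (tauGen n a.1.2).2)

/-- The image of `a_{ij}^ε` in the quotient group. -/
def quotGen (x : GenP n) : Qgrp n :=
  bif x.2 then quotT x.1.1.1 * quotA x.1 * quotT x.1.1.1 else quotA x.1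

theorem conj_snd_eq_conj_fst (a : GenG n) :
    quotT a.1.2 * quotA a * quotT a.1.2 = quotT a.1.1 * quotA a * quotT a.1.1 := by
  have h := quotA_mul_quotT a
  rw [← (quotT_commute a.1.1 a.1.2).eq] at h
  have h₁ := quotT_mul_self a.1.1
  calc quotT a.1.2 * quotA a * quotT a.1.2
      = (quotT a.1.1 * quotT a.1.1) * quotT a.1.2 * quotA a * quotT a.1.2 := by
        rw [h₁, one_mul]
    _ = quotT a.1.1 * (quotT a.1.1 * quotT a.1.2 * quotA a) * quotT a.1.2 := by group
    _ = quotT a.1.1 * quotA a * quotT a.1.1 * (quotT a.1.2 * quotT a.1.2) := by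
        rw [← h]; group
    _ = _ := by rw [quotT_mul_self, mul_one]

theorem conj_quotGen (k : Fin n) (x : GenP n) :
    MulAut.conj (quotT k) (quotGen x) = quotGen (flipGen (fun i => decide (i = k)) x) := by
  obtain ⟨a, e⟩ := x
  have hne := a.2.ne
  have hconj (g : Qgrp n) (i : Fin n) : quotT i * (quotT i * g * quotT i) * quotT i = g := by
    simp only [mul_assoc, quotT_mul_self, mul_one]
    rw [← mul_assoc, quotT_mul_self, one_mul]
  rw [MulAut.conj_apply, quotT_inv]
  by_cases h₁ : a.1.1 = k
  · subst h₁
    cases e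
    · simp [quotGen, flipGen, hne.symm]
    · simp [quotGen, flipGen, hne.symm, hconj]
  · by_cases h₂ : a.1.2 = k
    · subst h₂
      cases e
      · simp [quotGen, flipGen, hne, conj_snd_eq_conj_fst]
      · simp [quotGen, flipGen, hne, ← conj_snd_eq_conj_fst, hconj]
    · have hc := quotT_commute_quotA (Ne.symm h₁) (Ne.symm h₂)
      have hx : Commute (quotT k) (quotGen (a, e)) := by
        cases e
        · exact hc
        · exact ((quotT_commute _ _).mul_right hc).mul_right (quotT_commute _ _)
      rw [hx.eq, mul_assoc, quotT_mul_self, mul_one]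
      simp [flipGen, h₁, h₂]

theorem quotGen_triple {i j k : Fin n} (hij : i < j) (hik : i < k) (hjk : j < k)
    {e₁ e₂ e₃ : Bool} (he : Bool.xor e₁ (Bool.xor e₂ e₃) = false) :
    quotGen (⟨(i, j), hij⟩, e₁) * quotGen (⟨(i, k), hik⟩, e₂) * quotGen (⟨(j, k), hjk⟩, e₃) =
      quotGen (⟨(j, k), hjk⟩, e₃) * quotGen (⟨(i, k), hik⟩, e₂) *
        quotGen (⟨(i, j), hij⟩, e₁) := by
  have h₀ : quotGen (⟨(i, j), hij⟩, false) * quotGen (⟨(i, k), hik⟩, false) *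
      quotGen (⟨(j, k), hjk⟩, false) = quotGen (⟨(j, k), hjk⟩, false) *
      quotGen (⟨(i, k), hik⟩, false) * quotGen (⟨(i, j), hij⟩, false) :=
    quotA_triple hij hik hjk
  have h (l : Fin n) := congrArg (MulAut.conj (quotT l)) h₀
  simp only [map_mul, conj_quotGen, flipGen] at h
  cases e₁ <;> cases e₂ <;> cases e₃ <;> simp at he
  · exact h₀
  · simpa [hik.ne, hjk.ne] using h k
  · simpa [hij.ne, hjk.ne'] using h j
  · simpa [hij.ne', hik.ne'] using h i

theorem quotGen_lift_eq_one :
    ∀ r ∈ relsP n, FreeGroup.lift (quotGen (n := n)) r = 1 := by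
  refine G2p.lift_eq_one ?_ ?_ fun i j k hij hik hjk _ _ _ he => quotGen_triple hij hik hjk he
  · have hA (a : GenG n) : quotGen (a, false) * quotGen (a, false) = 1 := quotA_mul_self a
    rintro ⟨a, _ | _⟩
    · exact hA a
    · have h := congrArg (MulAut.conj (quotT a.1.1)) (hA a)
      simpa only [map_mul, map_one, conj_quotGen, flipGen, a.2.ne', decide_true, decide_false,
        Bool.xor_false, Bool.false_xor] using h
  · intro a b e₁ e₂ h
    obtain ⟨h₁, h₂, h₃, h₄⟩ := ne_of_card_insert_eq_four h
    have hT : ∀ e₂, Commute (quotT a.1.1) (quotGen (b, e₂)) := by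
      rintro (_ | _)
      · exact quotT_commute_quotA h₁ h₂
      · exact ((quotT_commute _ _).mul_right (quotT_commute_quotA h₁ h₂)).mul_right
          (quotT_commute _ _)
    have hA : ∀ e₂, Commute (quotA a) (quotGen (b, e₂)) := by
      have hTb := (quotT_commute_quotA (a := a) h₁.symm h₃.symm).symm
      rintro (_ | _)
      · exact quotA_commute h
      · exact (hTb.mul_right (quotA_commute h)).mul_right hTb
    cases e₁
    · exact hA e₂
    · exact ((hT e₂).mul_left (hA e₂)).mul_left (hT e₂)

/-- The homomorphism sending `a_{ij}^0` to `a_{ij}` and `a_{ij}^1` to `τ_i a_{ij} τ_i`. -/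
def omegaPhi (n : ℕ) : G2p n →* Qgrp n := PresentedGroup.toGroup quotGen_lift_eq_one

theorem omegaPhi_of (x : GenP n) : omegaPhi n (PresentedGroup.of x) = quotGen x :=
  PresentedGroup.toGroup.of _

end Forward

section Backward

variable {n : ℕ}

/-- The extension of `G2p n` by its automorphisms. -/
abbrev G2pHol (n : ℕ) := G2p n ⋊[MonoidHom.id (MulAut (G2p n))] MulAut (G2p n)

/-- The automorphism of `G2p n` given by conjugation by `τ_i`. -/
def tauAut (i : Fin n) : MulAut (G2p n) := flipAut fun j => decide (j = i)

theorem tauAut_of (i : Fin n) (a : GenG n) (e : Bool) :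
    tauAut i (PresentedGroup.of (a, e)) =
      PresentedGroup.of
        (a, Bool.xor e (Bool.xor (decide (a.1.1 = i)) (decide (a.1.2 = i)))) :=
  flipAut_of _ _

/-- The image in `G2pHol n` of a generator of `G2 (n + 1)`. -/
def holGen (a : GenG (n + 1)) : G2pHol n :=
  if h : a.1.2 = Fin.last n then
    SemidirectProduct.inr (tauAut (a.1.1.castPred (h ▸ a.2).ne))
  else
    SemidirectProduct.inl (PresentedGroup.of
      (⟨(a.1.1.castPred (a.2.trans_le (Fin.le_last _)).ne, a.1.2.castPred h), by
        simpa using a.2⟩, false))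

theorem holGen_tauGen (i : Fin n) :
    holGen (tauGen n i) = SemidirectProduct.inr (tauAut i) := by
  simp [holGen, tauGen]

theorem holGen_embedGen (a : GenG n) :
    holGen (embedGen n a) = SemidirectProduct.inl (PresentedGroup.of (a, false)) := by
  simp [holGen, embedGen, Fin.castSucc_ne_last]

theorem exists_eq_embedGen_or_tauGen (a : GenG (n + 1)) :
    (∃ b, a = embedGen n b) ∨ ∃ i, a = tauGen n i := by
  obtain ⟨⟨x, y⟩, h⟩ := a
  have hx : x ≠ Fin.last n := (h.trans_le (Fin.le_last _)).ne
  obtain ⟨i, rfl⟩ := Fin.exists_castSucc_eq.mpr hx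
  induction y using Fin.lastCases with
  | last => exact Or.inr ⟨i, rfl⟩
  | cast j => exact Or.inl ⟨⟨(i, j), Fin.castSucc_lt_castSucc_iff.mp h⟩, rfl⟩

theorem inr_mul_inl (s : MulAut (G2p n)) (x : G2p n) :
    (SemidirectProduct.inr s * SemidirectProduct.inl x : G2pHol n) =
      SemidirectProduct.inl (s x) * SemidirectProduct.inr s := by
  ext <;> simp

theorem holGen_tau_comm_embed {i : Fin n} {a : GenG n} (h₁ : a.1.1 ≠ i) (h₂ : a.1.2 ≠ i) :
    Commute (holGen (tauGen n i)) (holGen (embedGen n a)) := by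
  rw [holGen_tauGen, holGen_embedGen, Commute, SemiconjBy, inr_mul_inl, tauAut_of]
  simp [h₁, h₂]

theorem holGen_lift_eq_one :
    ∀ r ∈ relsG (n + 1), FreeGroup.lift (holGen (n := n)) r = 1 := by
  refine G2.lift_eq_one ?_ ?_ ?_
  · intro a
    obtain ⟨b, rfl⟩ | ⟨i, rfl⟩ := exists_eq_embedGen_or_tauGen a
    · rw [holGen_embedGen, ← map_mul, G2p.of_mul_self, map_one]
    · rw [holGen_tauGen, ← map_mul, tauAut, flipAut_mul_self, map_one]
  · intro a b h
    obtain ⟨h₁, h₂, h₃, h₄⟩ := ne_of_card_insert_eq_four h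
    obtain ⟨a, rfl⟩ | ⟨i, rfl⟩ := exists_eq_embedGen_or_tauGen a <;>
      obtain ⟨b, rfl⟩ | ⟨j, rfl⟩ := exists_eq_embedGen_or_tauGen b
    · rw [holGen_embedGen, holGen_embedGen, ← map_mul, ← map_mul, G2p.of_comm]
      have ha := a.2.ne
      have hb := b.2.ne
      simp only [embedGen, ne_eq, Fin.castSucc_inj] at h₁ h₂ h₃ h₄
      exact card_insert_eq_four ha hb h₁ h₂ h₃ h₄
    · exact (holGen_tau_comm_embed (by simpa [embedGen, tauGen] using h₁)
        (by simpa [embedGen, tauGen] using h₃)).symm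
    · exact holGen_tau_comm_embed (by simpa [embedGen, tauGen] using h₁.symm)
        (by simpa [embedGen, tauGen] using h₂.symm)
    · exact absurd rfl h₄
  · intro i j k hij hik hjk
    obtain ⟨i, rfl⟩ := Fin.exists_castSucc_eq.mpr (hij.trans_le (Fin.le_last _)).ne
    obtain ⟨j, rfl⟩ := Fin.exists_castSucc_eq.mpr (hjk.trans_le (Fin.le_last _)).ne
    have hij' : i < j := Fin.castSucc_lt_castSucc_iff.mp hij
    induction k using Fin.lastCases with
    | last =>
      change holGen (embedGen n ⟨(i, j), hij'⟩) * holGen (tauGen n i) * holGen (tauGen n j) =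
        holGen (tauGen n j) * holGen (tauGen n i) * holGen (embedGen n ⟨(i, j), hij'⟩)
      rw [holGen_embedGen, holGen_tauGen, holGen_tauGen, mul_assoc, ← map_mul, ← map_mul,
        inr_mul_inl, MulAut.mul_apply, tauAut_of, tauAut_of, tauAut, tauAut, flipAut_comm]
      simp [hij'.ne, hij'.ne']
    | cast k =>
      have hik' : i < k := Fin.castSucc_lt_castSucc_iff.mp hik
      have hjk' : j < k := Fin.castSucc_lt_castSucc_iff.mp hjk
      have h := congrArg (SemidirectProduct.inl (φ := MonoidHom.id (MulAut (G2p n))))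
        (G2p.of_triple hij' hik' hjk' (e₁ := false) (e₂ := false) (e₃ := false) rfl)
      simp only [map_mul, ← holGen_embedGen] at h
      exact h

/-- The homomorphism `G2 (n + 1) →* G2pHol n` extending `holGen`. -/
def holHom (n : ℕ) : G2 (n + 1) →* G2pHol n := PresentedGroup.toGroup holGen_lift_eq_one

theorem holHom_of (a : GenG (n + 1)) : holHom n (PresentedGroup.of a) = holGen a :=
  PresentedGroup.toGroup.of _

theorem normalClosure_QRels_le_ker : Subgroup.normalClosure (QRels n) ≤ (holHom n).ker := by
  refine Subgroup.normalClosure_le_normal ?_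
  rintro _ ⟨i, j, -, rfl⟩
  simp only [SetLike.mem_coe, MonoidHom.mem_ker, map_mul, map_inv, mul_inv_eq_one, holHom_of,
    holGen_tauGen]
  rw [← map_mul, ← map_mul, tauAut, tauAut, flipAut_comm]

/-- The homomorphism `Qgrp n →* G2pHol n` induced by `holHom`. -/
def quotHol (n : ℕ) : Qgrp n →* G2pHol n :=
  QuotientGroup.lift _ (holHom n) normalClosure_QRels_le_ker

theorem quotHol_quotA (a : GenG n) :
    quotHol n (quotA a) = SemidirectProduct.inl (PresentedGroup.of (a, false)) :=
  (holHom_of _).trans (holGen_embedGen a)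

theorem quotHol_quotT (i : Fin n) :
    quotHol n (quotT i) = SemidirectProduct.inr (tauAut i) :=
  (holHom_of _).trans (holGen_tauGen i)

theorem quotHol_comp_omegaPhi :
    (quotHol n).comp (omegaPhi n) = SemidirectProduct.inl := by
  ext1 ⟨a, e⟩
  rw [MonoidHom.comp_apply, omegaPhi_of]
  cases e
  · exact quotHol_quotA a
  · change quotHol n (quotT a.1.1 * quotA a * quotT a.1.1) = _
    rw [map_mul, map_mul, quotHol_quotA, quotHol_quotT, inr_mul_inl, mul_assoc, ← map_mul,
      tauAut_of, tauAut, flipAut_mul_self, map_one, mul_one]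
    simp [a.2.ne']

end Backward

theorem omega_phi_injective (n : ℕ) :
    ∃ f : G2p n →* Qgrp n,
      (∀ a : GenG n,
        f (PresentedGroup.of (a, false)) = QuotientGroup.mk (PresentedGroup.of (embedGen n a)) ∧
        f (PresentedGroup.of (a, true)) =
          QuotientGroup.mk (PresentedGroup.of (tauGen n a.1.1) *
            PresentedGroup.of (embedGen n a) * PresentedGroup.of (tauGen n a.1.1))) ∧
      Function.Injective f := by
  refine ⟨omegaPhi n, fun a => ⟨omegaPhi_of _, omegaPhi_of _⟩, ?_⟩
  have h : Function.Injective ((quotHol n).comp (omegaPhi n)) := by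
    rw [quotHol_comp_omegaPhi]
    exact SemidirectProduct.inl_injective
  exact Function.Injective.of_comp (f := quotHol n) h
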